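/- arXiv:2605.11785 — 4 statements merged into one kernel-verified Lean document; each statement's English description precedes it below -/
import Mathlib

section
/- Let T > 0, let b : ℝ^d × ℝ^d → ℝ^d be Borel measurable, bounded, and Lipschitz continuous in its first variable uniformly in the second (with Lipschitz constant K), let μ₀ be a Borel probability measure on ℝ^d with finite first moment and mean μ̄₀ = ∫ x μ₀(dx), and let 𝐱 : [0,T] → ℝ^d be continuous. Then there exists a unique continuous map z : [0,T] × ℝ^d → ℝ^d with at most linear growth (i.e. sup over (t,x) of |z(t,x)|/(1+|x|) is finite) such that for all (t,x) ∈ [0,T] × ℝ^d: z(t,x) = x − μ̄₀ + ∫₀ᵗ b(z(s,x) + 𝐱_s, 𝐱_s) ds − ∫₀ᵗ ∫_{ℝ^d} b(z(s,y) + 𝐱_s, 𝐱_s) μ₀(dy) ds. -/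
open MeasureTheory Set

noncomputable section

/-- `ℝ^d` with the Euclidean norm. -/
abbrev Ed (d : ℕ) := EuclideanSpace ℝ (Fin d)

/-- `z : [0,T] × ℝ^d → ℝ^d` is a continuous map with at most linear growth satisfying the
fixed-point equation
`z(t,x) = x − μ̄₀ + ∫₀ᵗ b(z(s,x)+xb_s, xb_s) ds − ∫₀ᵗ ∫ b(z(s,y)+xb_s, xb_s) μ₀(dy) ds`. -/
def IsFixedPt (d : ℕ) (T : ℝ) (b : Ed d → Ed d → Ed d) (μ₀ : Measure (Ed d))
    (xb : ℝ → Ed d) (z : ℝ → Ed d → Ed d) : Prop :=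
  ContinuousOn (fun p : ℝ × Ed d => z p.1 p.2) (Icc 0 T ×ˢ univ) ∧
  (∃ C : ℝ, ∀ t ∈ Icc 0 T, ∀ x : Ed d, ‖z t x‖ ≤ C * (1 + ‖x‖)) ∧
  ∀ t ∈ Icc 0 T, ∀ x : Ed d,
    z t x = x - (∫ y, y ∂μ₀)
      + (∫ s in (0:ℝ)..t, b (z s x + xb s) (xb s))
      - ∫ s in (0:ℝ)..t, ∫ y, b (z s y + xb s) (xb s) ∂μ₀

section Picard

open scoped BoundedContinuousFunction

variable {E : Type*} [NormedAddCommGroup E]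

/-- The velocity `b(x + u(s,x) + xe_s, xe_s)` at time `s` of the particle started at `x` whose
displacement is `u`. -/
def drift (b : E → E → E) (xe : ℝ → E) (u : ℝ × E → E) (s : ℝ) (x : E) : E :=
  b (x + u (s, x) + xe s) (xe s)

/-- The drift minus its average over the initial law. -/
def centredDrift [MeasurableSpace E] [NormedSpace ℝ E] (b : E → E → E)
    (μ : Measure E) (xe : ℝ → E) (u : ℝ × E → E)
    (s : ℝ) (x : E) : E :=
  drift b xe u s x - ∫ y, drift b xe u s y ∂μ

variable {b : E → E → E} {B K : ℝ} {xe : ℝ → E} {u v : ℝ × E → E}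

lemma continuous_of_norm_sub_le (hK : 0 ≤ K)
    (hLip : ∀ x x' z : E, ‖b x z - b x' z‖ ≤ K * ‖x - x'‖) (z : E) :
    Continuous (fun x => b x z) :=
  (LipschitzWith.of_dist_le_mul (K := K.toNNReal) fun x y => by
    simpa [dist_eq_norm, hK] using hLip x y z).continuous

lemma continuous_drift (hK : 0 ≤ K)
    (hLip : ∀ x x' z : E, ‖b x z - b x' z‖ ≤ K * ‖x - x'‖) (hu : Continuous u) (s : ℝ) :
    Continuous (drift b xe u s) :=
  (continuous_of_norm_sub_le hK hLip (xe s)).comp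
    (f := fun x => x + u (s, x) + xe s) (by fun_prop)

variable [MeasurableSpace E] {μ : Measure E}

section Bounds

variable [NormedSpace ℝ E]

lemma norm_integral_drift_le [IsProbabilityMeasure μ] (hB : ∀ x z, ‖b x z‖ ≤ B) (s : ℝ) :
    ‖∫ y, drift b xe u s y ∂μ‖ ≤ B := by
  simpa using norm_integral_le_of_norm_le_const (μ := μ) (f := drift b xe u s)
    (Filter.Eventually.of_forall fun _ => hB _ _)

lemma norm_centredDrift_le [IsProbabilityMeasure μ] (hB : ∀ x z, ‖b x z‖ ≤ B) (s : ℝ) (x : E) :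
    ‖centredDrift b μ xe u s x‖ ≤ 2 * B := by
  have h1 : ‖∫ y, drift b xe u s y ∂μ‖ ≤ B := norm_integral_drift_le hB s
  have h2 : ‖drift b xe u s x‖ ≤ B := hB _ _
  have h3 := norm_sub_le (drift b xe u s x) (∫ y, drift b xe u s y ∂μ)
  unfold centredDrift
  linarith

end Bounds

variable [BorelSpace E] [SecondCountableTopology E]

lemma measurable_drift (hb : Measurable (Function.uncurry b)) (hxe : Continuous xe)
    (hu : Continuous u) : Measurable (fun p : ℝ × E => drift b xe u p.1 p.2) := by
  have h1 : Continuous fun p : ℝ × E => (p.2 + u (p.1, p.2) + xe p.1, xe p.1) := by fun_prop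
  exact hb.comp h1.measurable

lemma integrable_drift [IsProbabilityMeasure μ] (hb : Measurable (Function.uncurry b))
    (hB : ∀ x z, ‖b x z‖ ≤ B) (hxe : Continuous xe) (hu : Continuous u) (s : ℝ) :
    Integrable (drift b xe u s) μ :=
  Integrable.of_bound
    ((measurable_drift hb hxe hu).comp measurable_prodMk_left).aestronglyMeasurable B
    (Filter.Eventually.of_forall fun _ => hB _ _)

lemma intervalIntegrable_drift (hb : Measurable (Function.uncurry b))
    (hB : ∀ x z, ‖b x z‖ ≤ B) (hxe : Continuous xe) (hu : Continuous u) (x : E) (t t' : ℝ) :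
    IntervalIntegrable (fun s => drift b xe u s x) volume t t' :=
  (intervalIntegrable_const (c := B)).mono_fun
    ((measurable_drift hb hxe hu).comp measurable_prodMk_right).aestronglyMeasurable
    (Filter.Eventually.of_forall fun _ => (hB _ _).trans (le_abs_self B))

variable [NormedSpace ℝ E]

lemma stronglyMeasurable_integral_drift [IsProbabilityMeasure μ]
    (hb : Measurable (Function.uncurry b)) (hxe : Continuous xe) (hu : Continuous u) :
    StronglyMeasurable (fun s => ∫ y, drift b xe u s y ∂μ) :=
  (measurable_drift hb hxe hu).stronglyMeasurable.integral_prod_right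

lemma intervalIntegrable_integral_drift [IsProbabilityMeasure μ]
    (hb : Measurable (Function.uncurry b)) (hB : ∀ x z, ‖b x z‖ ≤ B) (hxe : Continuous xe)
    (hu : Continuous u) (t t' : ℝ) :
    IntervalIntegrable (fun s => ∫ y, drift b xe u s y ∂μ) volume t t' := by
  refine (intervalIntegrable_const (c := B)).mono_fun
    (stronglyMeasurable_integral_drift hb hxe hu).aestronglyMeasurable
    (Filter.Eventually.of_forall fun s => ?_)
  exact (norm_integral_drift_le hB s).trans (le_abs_self B)

lemma intervalIntegrable_centredDrift [IsProbabilityMeasure μ]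
    (hb : Measurable (Function.uncurry b)) (hB : ∀ x z, ‖b x z‖ ≤ B) (hxe : Continuous xe)
    (hu : Continuous u) (x : E) (t t' : ℝ) :
    IntervalIntegrable (fun s => centredDrift b μ xe u s x) volume t t' :=
  (intervalIntegrable_drift hb hB hxe hu x t t').sub
    (intervalIntegrable_integral_drift hb hB hxe hu t t')

lemma integral_centredDrift [IsProbabilityMeasure μ]
    (hb : Measurable (Function.uncurry b)) (hB : ∀ x z, ‖b x z‖ ≤ B) (hxe : Continuous xe)
    (hu : Continuous u) (x : E) (t t' : ℝ) :
    ∫ s in t..t', centredDrift b μ xe u s x =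
      (∫ s in t..t', drift b xe u s x) - ∫ s in t..t', ∫ y, drift b xe u s y ∂μ :=
  intervalIntegral.integral_sub (intervalIntegrable_drift hb hB hxe hu x t t')
    (intervalIntegrable_integral_drift hb hB hxe hu t t')

lemma continuous_integral_centredDrift [IsProbabilityMeasure μ] (hK : 0 ≤ K)
    (hb : Measurable (Function.uncurry b)) (hB : ∀ x z, ‖b x z‖ ≤ B)
    (hLip : ∀ x x' z : E, ‖b x z - b x' z‖ ≤ K * ‖x - x'‖) (hxe : Continuous xe)
    (hu : Continuous u) :
    Continuous (fun p : ℝ × E => ∫ s in (0:ℝ)..p.1, centredDrift b μ xe u s p.2) := by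
  have hB0 : 0 ≤ B := (norm_nonneg _).trans (hB 0 0)
  refine continuous_prod_of_continuous_lipschitzWith _ (2 * B).toNNReal ?_ ?_
  · intro t
    refine intervalIntegral.continuous_of_dominated_interval (bound := fun _ => 2 * B)
      (fun x => ?_) (fun x => ?_) intervalIntegrable_const ?_
    · exact (intervalIntegrable_centredDrift hb hB hxe hu x 0 t).aestronglyMeasurable_restrict_uIoc
    · exact Filter.Eventually.of_forall fun s _ => norm_centredDrift_le hB s x
    · exact Filter.Eventually.of_forall fun s _ =>
        (continuous_drift hK hLip hu s).sub continuous_const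
  · intro x
    refine LipschitzWith.of_dist_le_mul fun t t' => ?_
    rw [dist_eq_norm, Real.coe_toNNReal _ (by positivity), dist_eq_norm,
      intervalIntegral.integral_interval_sub_left
      (intervalIntegrable_centredDrift hb hB hxe hu x _ _)
      (intervalIntegrable_centredDrift hb hB hxe hu x _ _)]
    exact intervalIntegral.norm_integral_le_of_norm_le_const
      fun s _ => norm_centredDrift_le hB s x

lemma norm_centredDrift_sub_le [IsProbabilityMeasure μ] (hK : 0 ≤ K)
    (hb : Measurable (Function.uncurry b)) (hB : ∀ x z, ‖b x z‖ ≤ B)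
    (hLip : ∀ x x' z : E, ‖b x z - b x' z‖ ≤ K * ‖x - x'‖) (hxe : Continuous xe)
    (hu : Continuous u) (hv : Continuous v) {s r : ℝ} (h : ∀ x, ‖u (s, x) - v (s, x)‖ ≤ r)
    (x : E) :
    ‖centredDrift b μ xe u s x - centredDrift b μ xe v s x‖ ≤ 2 * K * r := by
  have key (y : E) : ‖drift b xe u s y - drift b xe v s y‖ ≤ K * r := by
    refine (hLip _ _ _).trans (mul_le_mul_of_nonneg_left ?_ hK)
    simpa using h y
  have hint : ‖(∫ y, drift b xe u s y ∂μ) - ∫ y, drift b xe v s y ∂μ‖ ≤ K * r := by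
    rw [← integral_sub (integrable_drift hb hB hxe hu s) (integrable_drift hb hB hxe hv s)]
    simpa using norm_integral_le_of_norm_le_const (μ := μ) (Filter.Eventually.of_forall key)
  unfold centredDrift
  rw [sub_sub_sub_comm]
  refine (norm_sub_le _ _).trans ?_
  linarith [key x]

/-- The Picard map on bounded displacements; its values depend on time only through the
projection onto `[0,T]`. -/
lemma exists_picardMap [IsProbabilityMeasure μ] (hK : 0 ≤ K)
    (hb : Measurable (Function.uncurry b)) (hB : ∀ x z, ‖b x z‖ ≤ B)
    (hLip : ∀ x x' z : E, ‖b x z - b x' z‖ ≤ K * ‖x - x'‖) (hxe : Continuous xe)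
    {T : ℝ} (hT : 0 ≤ T) (m : E) :
    ∃ Φ : (ℝ × E →ᵇ E) → (ℝ × E →ᵇ E), ∀ u t x, Φ u (t, x) =
      -m + ∫ s in (0:ℝ)..(projIcc 0 T hT t : ℝ), centredDrift b μ xe u s x := by
  have hB0 : 0 ≤ B := (norm_nonneg _).trans (hB 0 0)
  refine ⟨fun u => BoundedContinuousFunction.ofNormedAddCommGroup
    (fun p => -m + ∫ s in (0:ℝ)..(projIcc 0 T hT p.1 : ℝ), centredDrift b μ xe u s p.2)
    ?_ (‖m‖ + 2 * B * T) ?_, fun u t x => rfl⟩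
  · have h1 : Continuous fun p : ℝ × E => ((projIcc 0 T hT p.1 : ℝ), p.2) := by
      have := continuous_projIcc (h := hT)
      fun_prop
    exact continuous_const.add
      ((continuous_integral_centredDrift hK hb hB hLip hxe u.continuous).comp h1)
  · intro p
    have h1 := intervalIntegral.norm_integral_le_of_norm_le_const (a := 0)
      (b := (projIcc 0 T hT p.1 : ℝ))
      fun s _ => norm_centredDrift_le (μ := μ) (xe := xe) (u := u) hB s p.2
    have h2 := (projIcc 0 T hT p.1).2
    rw [sub_zero, abs_of_nonneg h2.1] at h1
    refine (norm_add_le _ _).trans ?_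
    rw [norm_neg]
    gcongr
    exact h1.trans (by gcongr; exact h2.2)

lemma norm_iterate_picardMap_sub_le [IsProbabilityMeasure μ] (hK : 0 ≤ K)
    (hb : Measurable (Function.uncurry b)) (hB : ∀ x z, ‖b x z‖ ≤ B)
    (hLip : ∀ x x' z : E, ‖b x z - b x' z‖ ≤ K * ‖x - x'‖) (hxe : Continuous xe)
    {T : ℝ} (hT : 0 ≤ T) {m : E} {Φ : (ℝ × E →ᵇ E) → (ℝ × E →ᵇ E)}
    (hΦ : ∀ u t x, Φ u (t, x) =
      -m + ∫ s in (0:ℝ)..(projIcc 0 T hT t : ℝ), centredDrift b μ xe u s x)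
    (u v : ℝ × E →ᵇ E) (n : ℕ) (t : ℝ) (x : E) :
    ‖Φ^[n] u (t, x) - Φ^[n] v (t, x)‖ ≤
      (2 * K * (projIcc 0 T hT t : ℝ)) ^ n / n.factorial * dist u v := by
  induction n generalizing t x with
  | zero =>
    simpa [dist_eq_norm] using
      BoundedContinuousFunction.dist_coe_le_dist (f := u) (g := v) (t, x)
  | succ n ih =>
    rw [Function.iterate_succ_apply', Function.iterate_succ_apply', hΦ, hΦ,
      add_sub_add_left_eq_sub, ← intervalIntegral.integral_sub
        (intervalIntegrable_centredDrift hb hB hxe (Φ^[n] u).continuous x _ _)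
        (intervalIntegrable_centredDrift hb hB hxe (Φ^[n] v).continuous x _ _)]
    obtain ⟨τ, hτ⟩ := projIcc 0 T hT t
    have hbound : ∀ s ∈ Ioc 0 τ,
        ‖centredDrift b μ xe (Φ^[n] u) s x - centredDrift b μ xe (Φ^[n] v) s x‖ ≤
          2 * K * ((2 * K * s) ^ n / n.factorial * dist u v) := by
      intro s hs
      refine norm_centredDrift_sub_le hK hb hB hLip hxe (Φ^[n] u).continuous
        (Φ^[n] v).continuous (fun y => ?_) x
      have h := ih s y
      rwa [projIcc_of_mem hT ⟨hs.1.le, hs.2.trans hτ.2⟩] at h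
    refine (intervalIntegral.norm_integral_le_of_norm_le hτ.1
      (Filter.Eventually.of_forall hbound)
      (Continuous.intervalIntegrable (by fun_prop) _ _)).trans_eq ?_
    have hrw : ∀ s : ℝ, 2 * K * ((2 * K * s) ^ n / n.factorial * dist u v) =
        ((2 * K) ^ (n + 1) / n.factorial * dist u v) * s ^ n := by
      intro s
      rw [mul_pow]
      ring
    simp_rw [hrw]
    rw [intervalIntegral.integral_const_mul, integral_pow, Nat.factorial_succ]
    have hn : (n.factorial : ℝ) ≠ 0 := by positivity
    have hn' : (n : ℝ) + 1 ≠ 0 := by positivity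
    push_cast
    field_simp
    ring

lemma existsUnique_fixedPoint_picardMap [CompleteSpace E] [IsProbabilityMeasure μ] (hK : 0 ≤ K)
    (hb : Measurable (Function.uncurry b)) (hB : ∀ x z, ‖b x z‖ ≤ B)
    (hLip : ∀ x x' z : E, ‖b x z - b x' z‖ ≤ K * ‖x - x'‖) (hxe : Continuous xe)
    {T : ℝ} (hT : 0 ≤ T) {m : E} {Φ : (ℝ × E →ᵇ E) → (ℝ × E →ᵇ E)}
    (hΦ : ∀ u t x, Φ u (t, x) =
      -m + ∫ s in (0:ℝ)..(projIcc 0 T hT t : ℝ), centredDrift b μ xe u s x) :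
    ∃! u, Function.IsFixedPt Φ u := by
  obtain ⟨n, hn⟩ := ((FloorSemiring.tendsto_pow_div_factorial_atTop (2 * K * T)).eventually
    (gt_mem_nhds one_pos)).exists
  have hcontr : ContractingWith ((2 * K * T) ^ n / n.factorial).toNNReal Φ^[n] := by
    refine ⟨by simpa using hn, LipschitzWith.of_dist_le_mul fun u v => ?_⟩
    rw [Real.coe_toNNReal _ (by positivity)]
    refine (BoundedContinuousFunction.dist_le (by positivity)).2 fun p => ?_
    rw [dist_eq_norm]
    refine (norm_iterate_picardMap_sub_le hK hb hB hLip hxe hT hΦ u v n p.1 p.2).trans ?_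
    have h2 := (projIcc 0 T hT p.1).2
    have h3 := h2.1
    gcongr
    exact h2.2
  exact ⟨_, hcontr.isFixedPt_fixedPoint_iterate,
    fun v hv => hcontr.fixedPoint_unique (hv.iterate n)⟩

end Picard

/-- Existence and uniqueness of the fixed point `𝒴^{μ₀}(·,·,xb)` (Lemma 2.3, first part). -/
theorem fixedPoint_exists_unique (d : ℕ) (T : ℝ) (hT : 0 < T)
    (b : Ed d → Ed d → Ed d)
    (hbMeas : Measurable (Function.uncurry b))
    (B : ℝ) (hbBdd : ∀ x z : Ed d, ‖b x z‖ ≤ B)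
    (K : ℝ) (hbLip : ∀ x x' z : Ed d, ‖b x z - b x' z‖ ≤ K * ‖x - x'‖)
    (μ₀ : Measure (Ed d)) [IsProbabilityMeasure μ₀]
    (hμ₀ : Integrable (fun x => x) μ₀)
    (xb : ℝ → Ed d) (hxb : ContinuousOn xb (Icc 0 T)) :
    ∃ z : ℝ → Ed d → Ed d, IsFixedPt d T b μ₀ xb z ∧
      ∀ z' : ℝ → Ed d → Ed d, IsFixedPt d T b μ₀ xb z' →
        ∀ t ∈ Icc 0 T, ∀ x : Ed d, z' t x = z t x := by
  set m := ∫ y, y ∂μ₀ with hm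
  have hK' : 0 ≤ max K 0 := le_max_right _ _
  have hLip : ∀ x x' z : Ed d, ‖b x z - b x' z‖ ≤ max K 0 * ‖x - x'‖ := fun x x' z =>
    (hbLip x x' z).trans (mul_le_mul_of_nonneg_right (le_max_left _ _) (norm_nonneg _))
  have hB0 : 0 ≤ B := (norm_nonneg _).trans (hbBdd 0 0)
  have hproj : Continuous fun t : ℝ => (projIcc 0 T hT.le t : ℝ) :=
    continuous_subtype_val.comp continuous_projIcc
  have hproj_eq : ∀ t ∈ Icc 0 T, (projIcc 0 T hT.le t : ℝ) = t := fun t ht => by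
    rw [projIcc_of_mem hT.le ht]
  set xe : ℝ → Ed d := fun t => xb (projIcc 0 T hT.le t) with hxe_def
  have hxe : Continuous xe := hxb.comp_continuous hproj fun t => (projIcc 0 T hT.le t).2
  have hxe_eq : ∀ t ∈ Icc 0 T, xe t = xb t := fun t ht => by
    simp only [hxe_def, hproj_eq t ht]
  -- the equation for `z` in terms of the displacement `u`
  have hformula : ∀ (z : ℝ → Ed d → Ed d) (u : ℝ × Ed d → Ed d), Continuous u →
      (∀ t ∈ Icc 0 T, ∀ x, z t x = x + u (t, x)) → ∀ t ∈ Icc 0 T, ∀ x,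
      ∫ s in (0:ℝ)..t, centredDrift b μ₀ xe u s x =
        (∫ s in (0:ℝ)..t, b (z s x + xb s) (xb s))
          - ∫ s in (0:ℝ)..t, ∫ y, b (z s y + xb s) (xb s) ∂μ₀ := by
    intro z u hu hz t ht x
    have hd : ∀ s ∈ uIcc 0 t, ∀ y, drift b xe u s y = b (z s y + xb s) (xb s) := by
      intro s hs y
      rw [uIcc_of_le ht.1] at hs
      have hs' : s ∈ Icc 0 T := ⟨hs.1, hs.2.trans ht.2⟩
      rw [drift, hxe_eq s hs', hz s hs']
    rw [integral_centredDrift hbMeas hbBdd hxe hu]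
    congr 1
    · exact intervalIntegral.integral_congr fun s hs => hd s hs x
    · exact intervalIntegral.integral_congr fun s hs => by simp only [hd s hs]
  obtain ⟨Φ, hΦ⟩ := exists_picardMap (μ := μ₀) hK' hbMeas hbBdd hLip hxe hT.le m
  obtain ⟨u, hu, huniq⟩ :=
    existsUnique_fixedPoint_picardMap hK' hbMeas hbBdd hLip hxe hT.le hΦ
  refine ⟨fun t x => x + u (t, x), ⟨?_, ⟨1 + ‖u‖, fun t _ x => ?_⟩, fun t ht x => ?_⟩, ?_⟩
  · exact (continuous_snd.add (u.continuous.comp (by fun_prop))).continuousOn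
  · have h1 := norm_add_le x (u (t, x))
    have h2 := u.norm_coe_le_norm (t, x)
    nlinarith [norm_nonneg x, norm_nonneg u]
  · have h1 := hΦ u t x
    rw [hu, hproj_eq t ht, hformula _ u u.continuous (fun _ _ _ => rfl) t ht x] at h1
    simp only [h1]
    abel
  · rintro z ⟨hzc, -, hz⟩ t ht x
    have hcont : Continuous fun p : ℝ × Ed d => z (projIcc 0 T hT.le p.1) p.2 - p.2 :=
      (hzc.comp_continuous (f := fun p : ℝ × Ed d => ((projIcc 0 T hT.le p.1 : ℝ), p.2))
        (by fun_prop) fun p => ⟨(projIcc 0 T hT.le p.1).2, mem_univ _⟩).sub continuous_snd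
    have hzu : ∀ s ∈ Icc 0 T, ∀ y, z s y = y + (z (projIcc 0 T hT.le s) y - y) := by
      intro s hs y
      rw [hproj_eq s hs]
      abel
    have hsol : ∀ s : ℝ, ∀ y, z (projIcc 0 T hT.le s) y - y = -m +
        ∫ r in (0:ℝ)..(projIcc 0 T hT.le s : ℝ), centredDrift b μ₀ xe
          (fun p : ℝ × Ed d => z (projIcc 0 T hT.le p.1) p.2 - p.2) r y := by
      intro s y
      rw [hformula z _ hcont hzu _ (projIcc 0 T hT.le s).2 y, hz _ (projIcc 0 T hT.le s).2 y]
      abel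
    let v : BoundedContinuousFunction (ℝ × Ed d) (Ed d) :=
      BoundedContinuousFunction.ofNormedAddCommGroup _ hcont (‖m‖ + 2 * B * T) fun p => by
        have h1 := intervalIntegral.norm_integral_le_of_norm_le_const (a := 0)
          (b := (projIcc 0 T hT.le p.1 : ℝ))
          fun s _ => norm_centredDrift_le (μ := μ₀) (xe := xe)
            (u := fun p : ℝ × Ed d => z (projIcc 0 T hT.le p.1) p.2 - p.2) hbBdd s p.2
        have h2 := (projIcc 0 T hT.le p.1).2
        rw [sub_zero, abs_of_nonneg h2.1] at h1
        rw [hsol]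
        refine (norm_add_le _ _).trans ?_
        rw [norm_neg]
        gcongr
        exact h1.trans (by gcongr; exact h2.2)
    have hv : v = u := huniq v (by
      ext1 p
      exact (hΦ v p.1 p.2).trans (hsol p.1 p.2).symm)
    rw [← hv, hzu t ht x]
    rfl

end
end

section
/- Under assumption (A), the fixed-point map is nonanticipating: for every μ₀ ∈ P₁(ℝ^d), every t ∈ [0,T], every x ∈ ℝ^d, and all continuous paths 𝐱, 𝐱' : [0,T] → ℝ^d such that 𝐱_s = 𝐱'_s for all s ∈ [0,t], one has 𝒴^{μ₀}(t,x,𝐱) = 𝒴^{μ₀}(t,x,𝐱'). In particular 𝒴^{μ₀}(t,x,𝐱) = 𝒴^{μ₀}(t,x,𝐱(· ∧ t)). -/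
open MeasureTheory Set

noncomputable section

theorem add_sub_sub_add_sub {E : Type*} [AddCommGroup E] (a p q p' q' : E) :
    a + p - q - (a + p' - q') = p - p' - (q - q') := by
  abel

/-- The integrand of the fixed-point equation is jointly measurable in time and space. -/
theorem aestronglyMeasurable_drift {d : ℕ} {T : ℝ} {b : Ed d → Ed d → Ed d}
    (hb : Measurable (Function.uncurry b)) {xb : ℝ → Ed d} (hx : ContinuousOn xb (Icc 0 T))
    {z : ℝ → Ed d → Ed d}
    (hz : ContinuousOn (fun p : ℝ × Ed d => z p.1 p.2) (Icc 0 T ×ˢ univ))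
    (μ : Measure (Ed d)) [SFinite μ] :
    AEStronglyMeasurable (fun p : ℝ × Ed d => b (z p.1 p.2 + xb p.1) (xb p.1))
      ((volume.restrict (Icc 0 T)).prod μ) := by
  have hμ : (volume.restrict (Icc 0 T)).prod μ
      = ((volume : Measure ℝ).prod μ).restrict (Icc 0 T ×ˢ univ) := by
    rw [← Measure.prod_restrict, Measure.restrict_univ]
  rw [hμ]
  have hS : MeasurableSet ((Icc 0 T : Set ℝ) ×ˢ (univ : Set (Ed d))) :=
    measurableSet_Icc.prod MeasurableSet.univ
  have hxp : ContinuousOn (fun p : ℝ × Ed d => xb p.1) (Icc 0 T ×ˢ univ) :=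
    hx.comp continuousOn_fst fun p hp => hp.1
  exact (hb.comp_aemeasurable
    (((hz.add hxp).aemeasurable hS).prodMk (hxp.aemeasurable hS))).aestronglyMeasurable

/-- The drift averaged over space is integrable in time. -/
theorem intervalIntegrable_integral_drift_s3 {d : ℕ} {T : ℝ} {b : Ed d → Ed d → Ed d}
    (hb : Measurable (Function.uncurry b)) {B : ℝ} (hB : ∀ x z : Ed d, ‖b x z‖ ≤ B)
    {xb : ℝ → Ed d} (hx : ContinuousOn xb (Icc 0 T)) {z : ℝ → Ed d → Ed d}
    (hz : ContinuousOn (fun p : ℝ × Ed d => z p.1 p.2) (Icc 0 T ×ˢ univ))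
    (μ : Measure (Ed d)) [IsProbabilityMeasure μ] {t : ℝ} (ht : t ∈ Icc 0 T) :
    IntervalIntegrable (fun s => ∫ y, b (z s y + xb s) (xb s) ∂μ) volume 0 t := by
  rw [intervalIntegrable_iff_integrableOn_Ioc_of_le ht.1]
  have hm := (aestronglyMeasurable_drift hb hx hz μ).integral_prod_right'
  have hi : IntegrableOn (fun s => ∫ y, b (z s y + xb s) (xb s) ∂μ) (Icc 0 T) :=
    Integrable.of_bound hm B <| ae_of_all _ fun s => by
      simpa using norm_integral_le_of_norm_le_const (μ := μ)
        (ae_of_all _ fun y => hB (z s y + xb s) (xb s))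
  exact hi.mono_set fun s hs => ⟨hs.1.le, hs.2.trans ht.2⟩

theorem integrable_drift_s3 {d : ℕ} {T : ℝ} {b : Ed d → Ed d → Ed d}
    (hb : Measurable (Function.uncurry b)) {B : ℝ} (hB : ∀ x z : Ed d, ‖b x z‖ ≤ B)
    {z : ℝ → Ed d → Ed d}
    (hz : ContinuousOn (fun p : ℝ × Ed d => z p.1 p.2) (Icc 0 T ×ˢ univ))
    (μ : Measure (Ed d)) [IsFiniteMeasure μ] {s : ℝ} (hs : s ∈ Icc 0 T) (v : Ed d) :
    Integrable (fun y => b (z s y + v) v) μ := by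
  have hc : Continuous (z s) := by
    rw [← continuousOn_univ]
    exact hz.comp (f := fun y : Ed d => (s, y)) (by fun_prop) fun y _ => ⟨hs, mem_univ y⟩
  have hm : Measurable fun y => Function.uncurry b (z s y + v, v) :=
    hb.comp ((hc.measurable.add_const v).prodMk measurable_const)
  exact Integrable.of_bound hm.aestronglyMeasurable B (ae_of_all _ fun y => hB _ _)

/-- A bound on the distance between two flows propagates to their averaged, time-integrated
drifts when the driving paths agree. -/
theorem norm_integral_drift_sub_le {d : ℕ} {T : ℝ} {b : Ed d → Ed d → Ed d}
    (hb : Measurable (Function.uncurry b)) {B : ℝ} (hB : ∀ x z : Ed d, ‖b x z‖ ≤ B)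
    {L : ℝ} (hL : 0 ≤ L) (hLip : ∀ x x' z : Ed d, ‖b x z - b x' z‖ ≤ L * ‖x - x'‖)
    {xb xb' : ℝ → Ed d} (hx : ContinuousOn xb (Icc 0 T)) (hx' : ContinuousOn xb' (Icc 0 T))
    {z z' : ℝ → Ed d → Ed d}
    (hz : ContinuousOn (fun p : ℝ × Ed d => z p.1 p.2) (Icc 0 T ×ˢ univ))
    (hz' : ContinuousOn (fun p : ℝ × Ed d => z' p.1 p.2) (Icc 0 T ×ˢ univ))
    (μ : Measure (Ed d)) [IsProbabilityMeasure μ] {t : ℝ} (ht : t ∈ Icc 0 T)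
    (heq : ∀ s ∈ Icc 0 t, xb s = xb' s) {φ : ℝ → ℝ} (hφ : Continuous φ)
    (hzφ : ∀ s ∈ Icc 0 t, ∀ y, ‖z s y - z' s y‖ ≤ φ s) :
    ‖(∫ s in (0:ℝ)..t, ∫ y, b (z s y + xb s) (xb s) ∂μ)
        - ∫ s in (0:ℝ)..t, ∫ y, b (z' s y + xb' s) (xb' s) ∂μ‖
      ≤ ∫ s in (0:ℝ)..t, L * φ s := by
  rw [← intervalIntegral.integral_sub (intervalIntegrable_integral_drift_s3 hb hB hx hz μ ht)
    (intervalIntegrable_integral_drift_s3 hb hB hx' hz' μ ht)]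
  refine intervalIntegral.norm_integral_le_of_norm_le ht.1 (ae_of_all _ fun s hs => ?_)
    ((continuous_const.mul hφ).intervalIntegrable 0 t)
  have hs' : s ∈ Icc 0 t := ⟨hs.1.le, hs.2⟩
  have hsT : s ∈ Icc 0 T := ⟨hs'.1, hs'.2.trans ht.2⟩
  rw [← heq s hs', ← integral_sub (integrable_drift_s3 hb hB hz μ hsT _)
    (integrable_drift_s3 hb hB hz' μ hsT _)]
  refine (norm_integral_le_of_norm_le_const (C := L * φ s) (ae_of_all _ fun y => ?_)).trans_eq
    (by simp)
  refine (hLip _ _ _).trans (mul_le_mul_of_nonneg_left ?_ hL)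
  rw [add_sub_add_right_eq_sub]
  exact hzφ s hs' y

theorem IsFixedPt.norm_sub_le_integral {d : ℕ} {T : ℝ} {b : Ed d → Ed d → Ed d}
    (hb : Measurable (Function.uncurry b)) {B : ℝ} (hB : ∀ x z : Ed d, ‖b x z‖ ≤ B)
    {L : ℝ} (hL : 0 ≤ L) (hLip : ∀ x x' z : Ed d, ‖b x z - b x' z‖ ≤ L * ‖x - x'‖)
    {μ₀ : Measure (Ed d)} [IsProbabilityMeasure μ₀]
    {xb xb' : ℝ → Ed d} (hx : ContinuousOn xb (Icc 0 T)) (hx' : ContinuousOn xb' (Icc 0 T))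
    {z z' : ℝ → Ed d → Ed d} (hz : IsFixedPt d T b μ₀ xb z) (hz' : IsFixedPt d T b μ₀ xb' z')
    {t : ℝ} (ht : t ∈ Icc 0 T) (heq : ∀ s ∈ Icc 0 t, xb s = xb' s)
    {φ : ℝ → ℝ} (hφ : Continuous φ) (hzφ : ∀ s ∈ Icc 0 t, ∀ y, ‖z s y - z' s y‖ ≤ φ s)
    (x : Ed d) :
    ‖z t x - z' t x‖ ≤ ∫ s in (0:ℝ)..t, 2 * L * φ s := by
  have hδ := norm_integral_drift_sub_le hb hB hL hLip hx hx' hz.1 hz'.1 (Measure.dirac x) ht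
    heq hφ hzφ
  have hμ := norm_integral_drift_sub_le hb hB hL hLip hx hx' hz.1 hz'.1 μ₀ ht heq hφ hzφ
  simp only [integral_dirac] at hδ
  have hint : ∫ s in (0:ℝ)..t, 2 * L * φ s = 2 * ∫ s in (0:ℝ)..t, L * φ s := by
    simp_rw [mul_assoc]
    rw [intervalIntegral.integral_const_mul]
  rw [hz.2.2 t ht x, hz'.2.2 t ht x, hint, two_mul, add_sub_sub_add_sub]
  exact (norm_sub_le _ _).trans (add_le_add hδ hμ)

/-- Picard-type iterated bound between two fixed points driven by paths that agree. -/
theorem IsFixedPt.norm_sub_le_pow_div_factorial {d : ℕ} {T : ℝ} {b : Ed d → Ed d → Ed d}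
    (hb : Measurable (Function.uncurry b)) {B : ℝ} (hB : ∀ x z : Ed d, ‖b x z‖ ≤ B)
    {L : ℝ} (hL : 0 ≤ L) (hLip : ∀ x x' z : Ed d, ‖b x z - b x' z‖ ≤ L * ‖x - x'‖)
    {μ₀ : Measure (Ed d)} [IsProbabilityMeasure μ₀]
    {xb xb' : ℝ → Ed d} (hx : ContinuousOn xb (Icc 0 T)) (hx' : ContinuousOn xb' (Icc 0 T))
    {z z' : ℝ → Ed d → Ed d} (hz : IsFixedPt d T b μ₀ xb z) (hz' : IsFixedPt d T b μ₀ xb' z')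
    {t : ℝ} (ht : t ∈ Icc 0 T) (heq : ∀ s ∈ Icc 0 t, xb s = xb' s) (n : ℕ) :
    ∀ s ∈ Icc 0 t, ∀ x,
      ‖z s x - z' s x‖ ≤ 4 * B * T * ((2 * L * s) ^ n / n.factorial) := by
  have hB0 : 0 ≤ B := (norm_nonneg _).trans (hB 0 0)
  induction n with
  | zero =>
    intro s hs x
    have hsT : s ∈ Icc 0 T := ⟨hs.1, hs.2.trans ht.2⟩
    have hδ : ∀ (w : ℝ → Ed d → Ed d) (p : ℝ → Ed d),
        ‖∫ r in (0:ℝ)..s, b (w r x + p r) (p r)‖ ≤ B * s := fun w p => by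
      simpa [abs_of_nonneg hs.1] using
        intervalIntegral.norm_integral_le_of_norm_le_const (a := 0) (b := s)
          fun r _ => hB (w r x + p r) (p r)
    have hμ : ∀ (w : ℝ → Ed d → Ed d) (p : ℝ → Ed d),
        ‖∫ r in (0:ℝ)..s, ∫ y, b (w r y + p r) (p r) ∂μ₀‖ ≤ B * s := fun w p => by
      simpa [abs_of_nonneg hs.1] using
        intervalIntegral.norm_integral_le_of_norm_le_const (a := 0) (b := s) (C := B)
          (f := fun r => ∫ y, b (w r y + p r) (p r) ∂μ₀)
          fun r _ => by
            simpa using norm_integral_le_of_norm_le_const (μ := μ₀)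
              (ae_of_all _ fun y => hB (w r y + p r) (p r))
    have hBs : B * s ≤ B * T := mul_le_mul_of_nonneg_left hsT.2 hB0
    rw [hz.2.2 s hsT x, hz'.2.2 s hsT x, add_sub_sub_add_sub]
    refine (norm_sub_le _ _).trans ((add_le_add (norm_sub_le _ _) (norm_sub_le _ _)).trans ?_)
    simp only [pow_zero, Nat.factorial_zero, Nat.cast_one, div_one, mul_one]
    linarith [hδ z xb, hδ z' xb', hμ z xb, hμ z' xb']
  | succ n ih =>
    intro s hs x
    have hsT : s ∈ Icc 0 T := ⟨hs.1, hs.2.trans ht.2⟩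
    refine (hz.norm_sub_le_integral hb hB hL hLip hx hx' hz' hsT
      (fun r hr => heq r ⟨hr.1, hr.2.trans hs.2⟩)
      (φ := fun r => 4 * B * T * ((2 * L * r) ^ n / n.factorial)) (by fun_prop)
      (fun r hr => ih r ⟨hr.1, hr.2.trans hs.2⟩) x).trans_eq ?_
    have hfun : ∀ r : ℝ, 2 * L * (4 * B * T * ((2 * L * r) ^ n / n.factorial))
        = (2 * L) ^ (n + 1) * (4 * B * T) / n.factorial * r ^ n := fun r => by
      rw [mul_pow]; ring
    simp_rw [hfun]
    rw [intervalIntegral.integral_const_mul, integral_pow, Nat.factorial_succ, mul_pow (2 * L) s]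
    have : (n.factorial : ℝ) ≠ 0 := by positivity
    have : (n : ℝ) + 1 ≠ 0 := by positivity
    push_cast
    field_simp
    simp

theorem IsFixedPt.eq_of_eqOn {d : ℕ} {T : ℝ} {b : Ed d → Ed d → Ed d}
    (hb : Measurable (Function.uncurry b)) {B : ℝ} (hB : ∀ x z : Ed d, ‖b x z‖ ≤ B)
    {K : ℝ} (hLip : ∀ x x' z : Ed d, ‖b x z - b x' z‖ ≤ K * ‖x - x'‖)
    {μ₀ : Measure (Ed d)} [IsProbabilityMeasure μ₀]
    {xb xb' : ℝ → Ed d} (hx : ContinuousOn xb (Icc 0 T)) (hx' : ContinuousOn xb' (Icc 0 T))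
    {z z' : ℝ → Ed d → Ed d} (hz : IsFixedPt d T b μ₀ xb z) (hz' : IsFixedPt d T b μ₀ xb' z')
    {t : ℝ} (ht : t ∈ Icc 0 T) (heq : ∀ s ∈ Icc 0 t, xb s = xb' s) (x : Ed d) :
    z t x = z' t x := by
  have hLip' : ∀ x x' z : Ed d, ‖b x z - b x' z‖ ≤ |K| * ‖x - x'‖ := fun x x' z =>
    (hLip x x' z).trans (mul_le_mul_of_nonneg_right (le_abs_self K) (norm_nonneg _))
  have hlim : Filter.Tendsto
      (fun n : ℕ => 4 * B * T * ((2 * |K| * t) ^ n / n.factorial)) Filter.atTop (nhds 0) := by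
    simpa using
      (FloorSemiring.tendsto_pow_div_factorial_atTop (2 * |K| * t)).const_mul (4 * B * T)
  have hle : ‖z t x - z' t x‖ ≤ 0 := ge_of_tendsto' hlim fun n =>
    hz.norm_sub_le_pow_div_factorial hb hB (abs_nonneg K) hLip' hx hx' hz' ht heq n t
      ⟨ht.1, le_rfl⟩ x
  exact sub_eq_zero.1 (norm_le_zero_iff.1 hle)

/-- The fixed point `𝒴^{μ₀}` is nonanticipating: if two paths agree on `[0,t]` then the
corresponding fixed points agree at time `t`; in particular
`𝒴^{μ₀}(t,x,xb) = 𝒴^{μ₀}(t,x,xb(·∧t))` (Lemma 2.3, nonanticipation). -/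
theorem fixedPoint_nonanticipating (d : ℕ) (T : ℝ) (hT : 0 < T)
    (b : Ed d → Ed d → Ed d)
    (hbMeas : Measurable (Function.uncurry b))
    (B : ℝ) (hbBdd : ∀ x z : Ed d, ‖b x z‖ ≤ B)
    (K : ℝ) (hbLip : ∀ x x' z : Ed d, ‖b x z - b x' z‖ ≤ K * ‖x - x'‖)
    (μ₀ : Measure (Ed d)) [IsProbabilityMeasure μ₀]
    (hμ₀ : Integrable (fun x => x) μ₀) :
    (∀ xb xb' : ℝ → Ed d, ContinuousOn xb (Icc 0 T) → ContinuousOn xb' (Icc 0 T) →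
      ∀ z z' : ℝ → Ed d → Ed d,
        IsFixedPt d T b μ₀ xb z → IsFixedPt d T b μ₀ xb' z' →
      ∀ t ∈ Icc 0 T, (∀ s ∈ Icc 0 t, xb s = xb' s) → ∀ x : Ed d, z t x = z' t x) ∧
    (∀ xb : ℝ → Ed d, ContinuousOn xb (Icc 0 T) →
      ∀ z z' : ℝ → Ed d → Ed d, ∀ t ∈ Icc 0 T,
        IsFixedPt d T b μ₀ xb z → IsFixedPt d T b μ₀ (fun s => xb (min s t)) z' →
      ∀ x : Ed d, z t x = z' t x) := by
  refine ⟨fun xb xb' hx hx' z z' hz hz' t ht heq x =>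
    hz.eq_of_eqOn hbMeas hbBdd hbLip hx hx' hz' ht heq x, fun xb hx z z' t ht hz hz' x => ?_⟩
  have hx' : ContinuousOn (fun s => xb (min s t)) (Icc 0 T) :=
    hx.comp (by fun_prop) fun s hs => ⟨le_min hs.1 ht.1, (min_le_left _ _).trans hs.2⟩
  exact hz.eq_of_eqOn hbMeas hbBdd hbLip hx hx' hz' ht
    (fun s hs => by rw [min_eq_left hs.2]) x

end
end

section
/- Under assumption (A), let N ≥ 1, let x₀¹, …, x₀^N ∈ ℝ^d, let 𝐱 : [0,T] → ℝ^d be continuous, and let m = (1/N) Σ_{j=1}^N δ_{x₀^j} be the empirical measure. If continuous functions y¹, …, y^N : [0,T] → ℝ^d satisfy, for all i ∈ {1,…,N} and all t ∈ [0,T], y^i_t = x₀^i − (1/N) Σ_{j=1}^N x₀^j + ∫₀ᵗ b(y^i_s + 𝐱_s, 𝐱_s) ds − ∫₀ᵗ (1/N) Σ_{j=1}^N b(y^j_s + 𝐱_s, 𝐱_s) ds, then y^i_t = 𝒴^{m}(t, x₀^i, 𝐱) for every i ∈ {1,…,N} and every t ∈ [0,T]. -/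
open MeasureTheory Set
open scoped ENNReal NNReal

noncomputable section

/-- Homogeneous integral form of Grönwall's inequality. -/
theorem eq_zero_of_le_mul_integral {T L : ℝ} {φ : ℝ → ℝ} (hφ : ContinuousOn φ (Icc 0 T))
    (hφ0 : ∀ t ∈ Icc 0 T, 0 ≤ φ t)
    (hle : ∀ t ∈ Icc 0 T, φ t ≤ L * ∫ s in (0:ℝ)..t, φ s) :
    ∀ t ∈ Icc 0 T, φ t = 0 := by
  intro t ht
  have hT : 0 ≤ T := ht.1.trans ht.2
  set ψ : ℝ → ℝ := IccExtend hT ((Icc 0 T).domRestrict φ)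
  have hψ : Continuous ψ := hφ.domRestrict.Icc_extend'
  have hψφ : ∀ s ∈ Icc 0 T, ψ s = φ s := fun s hs => IccExtend_of_mem hT _ hs
  have hint : ∀ r ∈ Icc 0 T, ∫ s in (0:ℝ)..r, ψ s = ∫ s in (0:ℝ)..r, φ s := fun r hr =>
    intervalIntegral.integral_congr fun s hs => by
      rw [uIcc_of_le hr.1] at hs
      exact hψφ s ⟨hs.1, hs.2.trans hr.2⟩
  have hderiv : ∀ r, HasDerivAt (fun r => ∫ s in (0:ℝ)..r, ψ s) (ψ r) r := fun r =>
    (hψ.integral_hasStrictDerivAt 0 r).hasDerivAt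
  have hzero := eq_zero_of_abs_deriv_le_mul_abs_self_of_eq_zero_right (K := |L|) (a := 0) (b := T)
    (fun r _ => (hderiv r).continuousAt.continuousWithinAt)
    (fun r _ => (hderiv r).hasDerivWithinAt) intervalIntegral.integral_same
    (fun r hr => by
      have hr' := Ico_subset_Icc_self hr
      rw [hψφ r hr', hint r hr', ← Real.norm_eq_abs, ← norm_mul, Real.norm_of_nonneg (hφ0 r hr')]
      exact (hle r hr').trans (Real.le_norm_self _)) t ht
  have := hle t ht
  rw [← hint t ht, hzero, mul_zero] at this
  exact this.antisymm (hφ0 t ht)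

theorem intervalIntegrable_drift_s4 {d : ℕ} {T : ℝ} {b : Ed d → Ed d → Ed d}
    (hbMeas : Measurable (Function.uncurry b)) {B : ℝ} (hbBdd : ∀ x z : Ed d, ‖b x z‖ ≤ B)
    {xb u : ℝ → Ed d} (hxb : ContinuousOn xb (Icc 0 T)) (hu : ContinuousOn u (Icc 0 T))
    {t : ℝ} (ht : t ∈ Icc 0 T) :
    IntervalIntegrable (fun s => b (u s + xb s) (xb s)) volume 0 t := by
  rw [intervalIntegrable_iff_integrableOn_Icc_of_le ht.1]
  have hsub : Icc 0 t ⊆ Icc 0 T := Icc_subset_Icc_right ht.2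
  have hpair : AEMeasurable (fun s => (u s + xb s, xb s)) (volume.restrict (Icc 0 t)) :=
    (((hu.add hxb).prodMk hxb).mono hsub).aemeasurable measurableSet_Icc
  exact IntegrableOn.of_bound measure_Icc_lt_top
    (hbMeas.comp_aemeasurable hpair).aestronglyMeasurable B (ae_of_all _ fun s => hbBdd _ _)

theorem integral_empirical {d N : ℕ} (x₀ : Fin N → Ed d) (f : Ed d → Ed d) :
    ∫ x, f x ∂((N : ℝ≥0∞)⁻¹ • ∑ j : Fin N, Measure.dirac (x₀ j))
      = (N : ℝ)⁻¹ • ∑ j : Fin N, f (x₀ j) := by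
  rw [integral_smul_measure, integral_finsetSum_measure fun j _ => integrable_dirac enorm_lt_top]
  simp

/-- Uniqueness for the mean-field particle system with given initial positions. -/
theorem particle_system_unique {d N : ℕ} {T : ℝ} {b : Ed d → Ed d → Ed d}
    (hbMeas : Measurable (Function.uncurry b)) {B : ℝ} (hbBdd : ∀ x z : Ed d, ‖b x z‖ ≤ B)
    {K : ℝ} (hbLip : ∀ x x' z : Ed d, ‖b x z - b x' z‖ ≤ K * ‖x - x'‖)
    {xb : ℝ → Ed d} (hxb : ContinuousOn xb (Icc 0 T)) {c : Fin N → Ed d}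
    {u v : Fin N → ℝ → Ed d}
    (hu : ∀ i, ContinuousOn (u i) (Icc 0 T)) (hv : ∀ i, ContinuousOn (v i) (Icc 0 T))
    (hueq : ∀ i, ∀ t ∈ Icc 0 T,
      u i t = c i + (∫ s in (0:ℝ)..t, b (u i s + xb s) (xb s))
        - ∫ s in (0:ℝ)..t, (N : ℝ)⁻¹ • ∑ j : Fin N, b (u j s + xb s) (xb s))
    (hveq : ∀ i, ∀ t ∈ Icc 0 T,
      v i t = c i + (∫ s in (0:ℝ)..t, b (v i s + xb s) (xb s))
        - ∫ s in (0:ℝ)..t, (N : ℝ)⁻¹ • ∑ j : Fin N, b (v j s + xb s) (xb s)) :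
    ∀ i, ∀ t ∈ Icc 0 T, u i t = v i t := by
  set φ : ℝ → ℝ := fun s => ∑ i, ‖u i s - v i s‖ with hφ_def
  have hφ : ContinuousOn φ (Icc 0 T) :=
    continuousOn_finsetSum _ fun i _ => ((hu i).sub (hv i)).norm
  have hφ0 : ∀ s, 0 ≤ φ s := fun s => Finset.sum_nonneg fun i _ => norm_nonneg _
  have hdrift : ∀ i s, ‖b (u i s + xb s) (xb s) - b (v i s + xb s) (xb s)‖
      ≤ |K| * ‖u i s - v i s‖ := fun i s =>
    calc _ ≤ K * ‖u i s + xb s - (v i s + xb s)‖ := hbLip _ _ _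
      _ ≤ |K| * ‖u i s - v i s‖ := by
        rw [add_sub_add_right_eq_sub]
        gcongr
        exact le_abs_self K
  have hbound : ∀ i, ∀ t ∈ Icc 0 T,
      ‖u i t - v i t‖ ≤ (2 * |K|) * ∫ s in (0:ℝ)..t, φ s := by
    intro i t ht
    have hIu := fun j => intervalIntegrable_drift_s4 hbMeas hbBdd hxb (hu j) ht
    have hIv := fun j => intervalIntegrable_drift_s4 hbMeas hbBdd hxb (hv j) ht
    have hMu : IntervalIntegrable (fun s => (N : ℝ)⁻¹ • ∑ j, b (u j s + xb s) (xb s))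
        volume 0 t := by
      simpa only [Pi.smul_def, Finset.sum_apply] using
        (IntervalIntegrable.sum Finset.univ fun j _ => hIu j).smul (N : ℝ)⁻¹
    have hMv : IntervalIntegrable (fun s => (N : ℝ)⁻¹ • ∑ j, b (v j s + xb s) (xb s))
        volume 0 t := by
      simpa only [Pi.smul_def, Finset.sum_apply] using
        (IntervalIntegrable.sum Finset.univ fun j _ => hIv j).smul (N : ℝ)⁻¹
    have hdiff : u i t - v i t = ∫ s in (0:ℝ)..t,
        ((b (u i s + xb s) (xb s) - b (v i s + xb s) (xb s))
          - ((N : ℝ)⁻¹ • ∑ j, b (u j s + xb s) (xb s)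
            - (N : ℝ)⁻¹ • ∑ j, b (v j s + xb s) (xb s))) := by
      rw [intervalIntegral.integral_sub ((hIu i).sub (hIv i)) (hMu.sub hMv),
        intervalIntegral.integral_sub (hIu i) (hIv i), intervalIntegral.integral_sub hMu hMv,
        hueq i t ht, hveq i t ht]
      abel
    have hφt : IntervalIntegrable φ volume 0 t :=
      (hφ.mono (by rw [uIcc_of_le ht.1]; exact Icc_subset_Icc_right ht.2)).intervalIntegrable
    rw [hdiff, ← intervalIntegral.integral_const_mul]
    refine intervalIntegral.norm_integral_le_of_norm_le ht.1 (ae_of_all _ fun s _ => ?_)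
      (hφt.const_mul _)
    have hself : ‖b (u i s + xb s) (xb s) - b (v i s + xb s) (xb s)‖ ≤ |K| * φ s :=
      (hdrift i s).trans <| by
        gcongr
        exact Finset.single_le_sum (f := fun j => ‖u j s - v j s‖)
          (fun j _ => norm_nonneg _) (Finset.mem_univ i)
    have hmean : ‖(N : ℝ)⁻¹ • ∑ j, b (u j s + xb s) (xb s)
        - (N : ℝ)⁻¹ • ∑ j, b (v j s + xb s) (xb s)‖ ≤ |K| * φ s := by
      rw [← smul_sub, ← Finset.sum_sub_distrib, norm_smul, norm_inv, Real.norm_natCast]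
      have hsum : ‖∑ j, (b (u j s + xb s) (xb s) - b (v j s + xb s) (xb s))‖ ≤ |K| * φ s := by
        rw [hφ_def, Finset.mul_sum]
        exact norm_sum_le_of_le _ fun j _ => hdrift j s
      exact (mul_le_of_le_one_left (norm_nonneg _) (Nat.cast_inv_le_one N)).trans hsum
    linarith [norm_sub_le (b (u i s + xb s) (xb s) - b (v i s + xb s) (xb s))
      ((N : ℝ)⁻¹ • ∑ j, b (u j s + xb s) (xb s) - (N : ℝ)⁻¹ • ∑ j, b (v j s + xb s) (xb s))]
  have hzero := eq_zero_of_le_mul_integral (L := N * (2 * |K|)) hφ (fun t _ => hφ0 t) fun t ht =>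
    (Finset.sum_le_card_nsmul _ _ _ fun i _ => hbound i t ht).trans_eq <| by
      rw [Finset.card_univ, Fintype.card_fin, nsmul_eq_mul, ← mul_assoc]
  intro i t ht
  have := (Finset.sum_eq_zero_iff_of_nonneg fun j _ => norm_nonneg _).1 (hzero t ht) i
    (Finset.mem_univ i)
  exact sub_eq_zero.1 (norm_eq_zero.1 this)

/-- Solutions of the `N`-particle ODE system coincide with the fixed point associated to the
empirical measure of the initial positions (Lemma 2.3, last assertion). -/
theorem particle_system_eq_fixedPoint (d : ℕ) (T : ℝ) (hT : 0 < T)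
    (b : Ed d → Ed d → Ed d)
    (hbMeas : Measurable (Function.uncurry b))
    (B : ℝ) (hbBdd : ∀ x z : Ed d, ‖b x z‖ ≤ B)
    (K : ℝ) (hbLip : ∀ x x' z : Ed d, ‖b x z - b x' z‖ ≤ K * ‖x - x'‖)
    (N : ℕ) (hN : 1 ≤ N) (x₀ : Fin N → Ed d)
    (xb : ℝ → Ed d) (hxb : ContinuousOn xb (Icc 0 T))
    -- `m` is the empirical measure of the initial positions
    (m : Measure (Ed d)) (hm : m = (N : ℝ≥0∞)⁻¹ • ∑ j : Fin N, Measure.dirac (x₀ j))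
    (z : ℝ → Ed d → Ed d) (hz : IsFixedPt d T b m xb z)
    (y : Fin N → ℝ → Ed d)
    (hycont : ∀ i, ContinuousOn (y i) (Icc 0 T))
    (hyeq : ∀ i, ∀ t ∈ Icc 0 T,
      y i t = x₀ i - (N : ℝ)⁻¹ • ∑ j : Fin N, x₀ j
        + (∫ s in (0:ℝ)..t, b (y i s + xb s) (xb s))
        - ∫ s in (0:ℝ)..t, (N : ℝ)⁻¹ • ∑ j : Fin N, b (y j s + xb s) (xb s)) :
    ∀ i, ∀ t ∈ Icc 0 T, y i t = z t (x₀ i) := by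
  subst hm
  obtain ⟨hzcont, -, hzeq⟩ := hz
  refine particle_system_unique (c := fun i => x₀ i - (N : ℝ)⁻¹ • ∑ j : Fin N, x₀ j)
    (v := fun i t => z t (x₀ i)) hbMeas hbBdd hbLip hxb hycont (fun i => ?_) hyeq
    fun i t ht => ?_
  · exact hzcont.comp (f := fun t => (t, x₀ i)) (by fun_prop) fun t ht => ⟨ht, mem_univ _⟩
  · simpa only [integral_empirical] using hzeq t ht (x₀ i)

end
end

section
/- Let μ₀ be a Borel probability measure on ℝ^d and let N ≥ k ≥ 1 be integers. Define the Borel probability measure η on (ℝ^d)^k by η = N^{−k} Σ_f (π_f)♯ μ₀^{⊗N}, where the sum runs over all N^k functions f : {1,…,k} → {1,…,N} and π_f : (ℝ^d)^N → (ℝ^d)^k maps (x₁,…,x_N) to (x_{f(1)},…,x_{f(k)}) (equivalently, η is the mean over μ₀^{⊗N} of the k-fold product of the empirical measure (1/N) Σ_{j=1}^N δ_{x_j}). Then the total variation distance satisfies: sup over Borel sets A ⊆ (ℝ^d)^k of |η(A) − μ₀^{⊗k}(A)| ≤ 1 − N!/(N^k · (N−k)!). -/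
open MeasureTheory Set
open scoped ENNReal

noncomputable section

/-- Selecting distinct coordinates of an i.i.d. family gives an i.i.d. family. -/
theorem map_pi_comp_of_injective {ι κ X : Type*} [Fintype ι] [Fintype κ] [MeasurableSpace X]
    (μ : Measure X) [IsProbabilityMeasure μ] {f : κ → ι} (hf : Function.Injective f) :
    (Measure.pi fun _ : ι => μ).map (fun x i => x (f i)) = Measure.pi fun _ : κ => μ := by
  have hindep : ProbabilityTheory.iIndepFun (fun i (x : ι → X) => x i)
      (Measure.pi fun _ : ι => μ) :=
    ProbabilityTheory.iIndepFun_pi (X := fun _ => id) fun _ => aemeasurable_id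
  rw [(ProbabilityTheory.iIndepFun_iff_map_fun_eq_pi_map (fun i => (measurable_pi_apply (f i)).aemeasurable)).1
    (hindep.precomp hf)]
  congr 1
  funext i
  exact (measurePreserving_eval (fun _ : ι => μ) (f i)).map_eq

theorem card_filter_injective (κ ι : Type*) [Fintype κ] [Fintype ι]
    [DecidableEq κ] [DecidablePred (Function.Injective : (κ → ι) → Prop)] :
    (Finset.univ.filter (Function.Injective : (κ → ι) → Prop)).card
      = (Fintype.card ι).descFactorial (Fintype.card κ) := by
  rw [← Fintype.card_subtype, Fintype.card_congr (Equiv.subtypeInjectiveEquivEmbedding κ ι),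
    Fintype.card_embedding_eq]

/-- The total variation distance between the mean over `μ₀^{⊗N}` of the `k`-fold product of the
empirical measure and the product measure `μ₀^{⊗k}` is at most `1 − N!/(N^k (N−k)!)`
(proof of Theorem 2.11). -/
theorem tv_mean_empirical_product_le (d : ℕ) (μ₀ : Measure (Ed d)) [IsProbabilityMeasure μ₀]
    (N k : ℕ) (hk : 1 ≤ k) (hkN : k ≤ N)
    (η : Measure (Fin k → Ed d))
    (hη : η = ((N : ℝ≥0∞) ^ k)⁻¹ • ∑ f : Fin k → Fin N,
        (Measure.pi fun _ : Fin N => μ₀).map (fun x i => x (f i))) :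
    ∀ A : Set (Fin k → Ed d), MeasurableSet A →
      |(η A).toReal - ((Measure.pi fun _ : Fin k => μ₀) A).toReal|
        ≤ 1 - (N.factorial : ℝ) / ((N : ℝ) ^ k * ((N - k).factorial : ℝ)) := by
  classical
  intro A hA
  subst hη
  have hN : (0 : ℝ) < (N : ℝ) ^ k := pow_pos (by exact_mod_cast hk.trans hkN) k
  set q := (Measure.pi fun _ : Fin k => μ₀).real A with hq
  set p : (Fin k → Fin N) → ℝ := fun f =>
    ((Measure.pi fun _ : Fin N => μ₀).map (fun x i => x (f i))).real A with hp
  have hprob (f : Fin k → Fin N) :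
      IsProbabilityMeasure ((Measure.pi fun _ : Fin N => μ₀).map (fun x i => x (f i))) :=
    Measure.isProbabilityMeasure_map (Measurable.aemeasurable (by fun_prop))
  have hη : ((((N : ℝ≥0∞) ^ k)⁻¹ • ∑ f : Fin k → Fin N,
      (Measure.pi fun _ : Fin N => μ₀).map (fun x i => x (f i))) A).toReal
      = ((N : ℝ) ^ k)⁻¹ * ∑ f, p f := by
    rw [Measure.smul_apply, Measure.finsetSum_apply, smul_eq_mul, ENNReal.toReal_mul,
      ENNReal.toReal_sum fun f _ => measure_ne_top _ _]
    simp [hp, Measure.real]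
  have hcard : ∑ _f : Fin k → Fin N, q = (N : ℝ) ^ k * q := by simp
  have hbound (f : Fin k → Fin N) :
      |p f - q| ≤ 1 - if Function.Injective f then 1 else 0 := by
    split_ifs with hf
    · simp only [hp, hq]
      rw [map_pi_comp_of_injective μ₀ hf]
      simp
    · rw [sub_zero]
      exact abs_sub_le_of_nonneg_of_le measureReal_nonneg measureReal_le_one
        measureReal_nonneg measureReal_le_one
  have hsum : |∑ f, p f - (N : ℝ) ^ k * q| ≤ (N : ℝ) ^ k - N.descFactorial k := by
    rw [← hcard, ← Finset.sum_sub_distrib]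
    refine (Finset.abs_sum_le_sum_abs _ _).trans
      ((Finset.sum_le_sum fun f _ => hbound f).trans_eq ?_)
    rw [Finset.sum_sub_distrib, Finset.sum_boole, card_filter_injective]
    simp
  have hfact : (N.factorial : ℝ) = (N - k).factorial * N.descFactorial k := by
    exact_mod_cast (Nat.factorial_mul_descFactorial hkN).symm
  have hfac : ((N - k).factorial : ℝ) ≠ 0 := by positivity
  change |_ - q| ≤ _
  calc _ = |∑ f, p f - (N : ℝ) ^ k * q| / (N : ℝ) ^ k := by
        rw [hη, ← abs_of_pos hN, ← abs_div, abs_of_pos hN]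
        congr 1
        field_simp
    _ ≤ ((N : ℝ) ^ k - N.descFactorial k) / (N : ℝ) ^ k := by gcongr
    _ = _ := by
        rw [hfact]
        field_simp

end
end
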